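/- arXiv:0709.4107 — 5 statements merged into one kernel-verified Lean document; each statement's English description precedes it below -/
import Mathlib

section
/- Let a : ℤ → ℂ be rapidly decreasing and suppose there is a rapidly decreasing b : ℤ → ℂ with a*b = e. Then there exist p ∈ ℤ, a nonzero constant c ∈ ℂ, and rapidly decreasing a⁺, a⁻ : ℤ → ℂ such that: a⁻ is strictly antiholomorphic and is a unit of W(ℂ) whose inverse is strictly antiholomorphic; a⁺ is strictly holomorphic and is a unit of W(ℂ) whose inverse is strictly holomorphic; and a = a⁻ * m * a⁺, where m(p) = c and m(n) = 0 for n ≠ p. -/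
open scoped BigOperators

/-- A function `a : ℤ → A` is rapidly decreasing if for every `k` the quantities
`(1+|n|)^k * ‖a n‖` are bounded. -/
def RapidlyDecreasing {A : Type*} [NormedRing A] (a : ℤ → A) : Prop :=
  ∀ k : ℕ, ∃ C : ℝ, ∀ n : ℤ, (1 + |(n : ℝ)|) ^ k * ‖a n‖ ≤ C

/-- The convolution product of the Wiener algebra `W(A)`:
`(a*b)(n) = ∑_{m∈ℤ} a(m)·b(n−m)`. -/
noncomputable def conv {A : Type*} [NormedRing A] (a b : ℤ → A) : ℤ → A :=
  fun n => ∑' m : ℤ, a m * b (n - m)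

/-- The multiplicative unit `e` of the Wiener algebra: `e(0)=1`, `e(n)=0` for `n≠0`. -/
def wone {A : Type*} [NormedRing A] : ℤ → A := fun n => if n = 0 then 1 else 0

/-- `a` is a unit of the Wiener algebra `W(A)`. -/
def IsWienerUnit {A : Type*} [NormedRing A] (a : ℤ → A) : Prop :=
  RapidlyDecreasing a ∧ ∃ b : ℤ → A, RapidlyDecreasing b ∧ conv a b = wone

/-- `a` is strictly holomorphic: `a(0)=1` and `a(n)=0` for `n<0`. -/
def StrictlyHolomorphic {A : Type*} [NormedRing A] (a : ℤ → A) : Prop :=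
  a 0 = 1 ∧ ∀ n : ℤ, n < 0 → a n = 0

/-- `a` is strictly antiholomorphic: `a(0)=1` and `a(n)=0` for `n>0`. -/
def StrictlyAntiholomorphic {A : Type*} [NormedRing A] (a : ℤ → A) : Prop :=
  a 0 = 1 ∧ ∀ n : ℤ, 0 < n → a n = 0

/-- `a` is an orthogonal Laurent series: `a(n)·a(m)=0` whenever `n≠m`. -/
def OrthogonalSeq {A : Type*} [NormedRing A] (a : ℤ → A) : Prop :=
  ∀ n m : ℤ, n ≠ m → a n * a m = 0

namespace WienerAlgebra

lemma RapidlyDecreasing.summable_weighted {a : ℤ → ℂ} (ha : RapidlyDecreasing a) (k : ℕ) :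
    Summable fun n : ℤ => (1 + |(n : ℝ)|) ^ k * ‖a n‖ := by
  obtain ⟨C, hC⟩ := ha (k + 2)
  have hs : Summable fun n : ℤ => C * (1 / |(n : ℝ) + 1 / 2| ^ (2 : ℝ)) :=
    ((Real.summable_one_div_int_add_rpow (1 / 2) 2).2 (by norm_num)).mul_left C
  refine hs.of_nonneg_of_le (fun n => by positivity) fun n => ?_
  have hne : (n : ℝ) + 1 / 2 ≠ 0 := by
    intro h
    have h2 : 2 * n + 1 = 0 := by
      have : (2 : ℝ) * n + 1 = 0 := by linarith
      exact_mod_cast this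
    omega
  have hpos : 0 < |(n : ℝ) + 1 / 2| := abs_pos.2 hne
  have hle : |(n : ℝ) + 1 / 2| ≤ 1 + |(n : ℝ)| := by
    refine (abs_add_le _ _).trans ?_
    norm_num [abs_of_pos]
    linarith
  rw [mul_one_div, Real.rpow_ofNat, le_div_iff₀ (by positivity)]
  refine le_trans ?_ (hC n)
  calc (1 + |(n : ℝ)|) ^ k * ‖a n‖ * |(n : ℝ) + 1 / 2| ^ 2
      ≤ (1 + |(n : ℝ)|) ^ k * ‖a n‖ * (1 + |(n : ℝ)|) ^ 2 := by gcongr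
    _ = _ := by ring

lemma RapidlyDecreasing.summable_norm {a : ℤ → ℂ} (ha : RapidlyDecreasing a) :
    Summable fun n => ‖a n‖ := by
  simpa using RapidlyDecreasing.summable_weighted ha 0

lemma RapidlyDecreasing.bounded {a : ℤ → ℂ} (ha : RapidlyDecreasing a) :
    ∃ C, ∀ n, ‖a n‖ ≤ C := by
  simpa using ha 0

lemma summable_conv {a b : ℤ → ℂ} (ha : RapidlyDecreasing a) (hb : ∃ C, ∀ n, ‖b n‖ ≤ C) (n : ℤ) :
    Summable fun m => a m * b (n - m) := by
  obtain ⟨C, hC⟩ := hb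
  refine Summable.of_norm_bounded
    ((RapidlyDecreasing.summable_norm ha).mul_right C) fun m => ?_
  rw [norm_mul]
  gcongr
  exact hC _

lemma conv_weighted_bound {a b : ℤ → ℂ} (ha : RapidlyDecreasing a) (k : ℕ)
    (hb : ∃ C : ℝ, ∀ n : ℤ, (1 + |(n : ℝ)|) ^ k * ‖b n‖ ≤ C) :
    ∃ C : ℝ, ∀ n : ℤ, (1 + |(n : ℝ)|) ^ k * ‖conv a b n‖ ≤ C := by
  obtain ⟨C, hC⟩ := hb
  have hs := RapidlyDecreasing.summable_weighted ha k
  refine ⟨(∑' m : ℤ, (1 + |(m : ℝ)|) ^ k * ‖a m‖) * C, fun n => ?_⟩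
  have hb : ∀ m, ‖(((1 + |(n : ℝ)|) ^ k : ℝ) : ℂ) * (a m * b (n - m))‖
      ≤ (1 + |(m : ℝ)|) ^ k * ‖a m‖ * C := fun m => by
    have h1 : 1 + |(n : ℝ)| ≤ (1 + |(m : ℝ)|) * (1 + |((n - m : ℤ) : ℝ)|) := by
      have : |(n : ℝ)| ≤ |(m : ℝ)| + |((n - m : ℤ) : ℝ)| := by
        push_cast
        simpa using abs_add_le (m : ℝ) (n - m)
      nlinarith [abs_nonneg (m : ℝ), abs_nonneg ((n - m : ℤ) : ℝ)]
    rw [norm_mul, norm_mul, Complex.norm_real, Real.norm_of_nonneg (by positivity)]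
    calc (1 + |(n : ℝ)|) ^ k * (‖a m‖ * ‖b (n - m)‖)
        ≤ ((1 + |(m : ℝ)|) * (1 + |((n - m : ℤ) : ℝ)|)) ^ k * (‖a m‖ * ‖b (n - m)‖) := by gcongr
      _ = (1 + |(m : ℝ)|) ^ k * ‖a m‖ * ((1 + |((n - m : ℤ) : ℝ)|) ^ k * ‖b (n - m)‖) := by
        rw [mul_pow]
        ring
      _ ≤ _ := by gcongr; exact hC _
  have h := tsum_of_norm_bounded (hs.mul_right C).hasSum hb
  rwa [tsum_mul_left, tsum_mul_right, norm_mul, Complex.norm_real,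
    Real.norm_of_nonneg (by positivity)] at h

lemma RapidlyDecreasing.conv {a b : ℤ → ℂ} (ha : RapidlyDecreasing a)
    (hb : RapidlyDecreasing b) : RapidlyDecreasing (conv a b) :=
  fun k => conv_weighted_bound ha k (hb k)

lemma conv_comm (a b : ℤ → ℂ) : conv a b = conv b a := by
  funext n
  unfold _root_.conv
  rw [← (Equiv.subLeft n).tsum_eq]
  exact tsum_congr fun m => by simp [mul_comm]

lemma conv_assoc {a b c : ℤ → ℂ} (ha : RapidlyDecreasing a) (hb : RapidlyDecreasing b)
    (hc : RapidlyDecreasing c) : conv (conv a b) c = conv a (conv b c) := by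
  funext n
  obtain ⟨C, hC⟩ := RapidlyDecreasing.bounded hc
  have hs : Summable fun x : ℤ × ℤ => a x.1 * (b (x.2 - x.1) * c (n - x.2)) := by
    have h1 := (RapidlyDecreasing.summable_norm ha).mul_of_nonneg
      (RapidlyDecreasing.summable_norm hb) (fun _ => norm_nonneg _) (fun _ => norm_nonneg _)
    let φ : ℤ × ℤ → ℤ × ℤ := fun x => (x.1, x.2 - x.1)
    have hφ : Function.Injective φ := by
      rintro ⟨x, y⟩ ⟨x', y'⟩ h
      simp only [φ, Prod.mk.injEq] at h ⊢
      omega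
    refine Summable.of_norm_bounded ((h1.comp_injective hφ).mul_right C) fun x => ?_
    rw [norm_mul, norm_mul, ← mul_assoc]
    simp only [Function.comp, φ]
    gcongr
    exact hC _
  have h2 : ∀ m, (∑' k, a k * b (m - k)) * c (n - m)
      = ∑' k, a k * (b (m - k) * c (n - m)) := fun m => by
    rw [← tsum_mul_right]
    exact tsum_congr fun k => by ring
  have h3 : ∀ k, a k * ∑' m, b m * c (n - k - m)
      = ∑' m, a k * (b (m - k) * c (n - m)) := fun k => by
    rw [← (Equiv.subRight k).tsum_eq, ← tsum_mul_left]
    exact tsum_congr fun m => by simp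
  unfold _root_.conv
  simp_rw [h2, h3]
  exact Summable.tsum_comm (f := fun k m => a k * (b (m - k) * c (n - m))) hs

lemma wone_conv (a : ℤ → ℂ) : conv wone a = a := by
  funext n
  unfold _root_.conv
  rw [tsum_eq_single 0 fun m hm => by simp [wone, hm]]
  simp [wone]

lemma conv_add {a b c : ℤ → ℂ} (ha : RapidlyDecreasing a) (hb : RapidlyDecreasing b)
    (hc : RapidlyDecreasing c) : conv a (b + c) = conv a b + conv a c := by
  funext n
  simp only [_root_.conv, Pi.add_apply, mul_add]
  exact (summable_conv ha (RapidlyDecreasing.bounded hb) n).tsum_add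
    (summable_conv ha (RapidlyDecreasing.bounded hc) n)

lemma rapidlyDecreasing_of_norm_le {a b : ℤ → ℂ} (hb : RapidlyDecreasing b)
    (h : ∀ n, ‖a n‖ ≤ ‖b n‖) : RapidlyDecreasing a := fun k => by
  obtain ⟨C, hC⟩ := hb k
  exact ⟨C, fun n => (mul_le_mul_of_nonneg_left (h n) (by positivity)).trans (hC n)⟩

lemma RapidlyDecreasing.add {a b : ℤ → ℂ} (ha : RapidlyDecreasing a)
    (hb : RapidlyDecreasing b) : RapidlyDecreasing (a + b) := fun k => by
  obtain ⟨C, hC⟩ := ha k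
  obtain ⟨C', hC'⟩ := hb k
  refine ⟨C + C', fun n => ?_⟩
  calc (1 + |(n : ℝ)|) ^ k * ‖a n + b n‖ ≤ (1 + |(n : ℝ)|) ^ k * (‖a n‖ + ‖b n‖) := by
        gcongr; exact norm_add_le _ _
    _ = (1 + |(n : ℝ)|) ^ k * ‖a n‖ + (1 + |(n : ℝ)|) ^ k * ‖b n‖ := by ring
    _ ≤ _ := add_le_add (hC n) (hC' n)

lemma rapidlyDecreasing_single (p : ℤ) (c : ℂ) :
    RapidlyDecreasing fun n => if n = p then c else 0 := fun k => by
  refine ⟨(1 + |(p : ℝ)|) ^ k * ‖c‖, fun n => ?_⟩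
  dsimp only
  split_ifs with h
  · rw [h]
  · simp only [norm_zero, mul_zero]
    positivity

/-- The rapidly decreasing sequences as an additive subgroup of `ℤ → ℂ`. -/
def rapidSubgroup : AddSubgroup (ℤ → ℂ) where
  carrier := {a | RapidlyDecreasing a}
  zero_mem' k := ⟨0, fun n => by simp⟩
  add_mem' ha hb := RapidlyDecreasing.add ha hb
  neg_mem' ha := rapidlyDecreasing_of_norm_le ha fun n => by simp

/-- The Wiener algebra `W(ℂ)`. -/
abbrev W : Type := rapidSubgroup

noncomputable instance : CommRing W where
  mul a b := ⟨conv a.1 b.1, RapidlyDecreasing.conv a.2 b.2⟩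
  one := ⟨wone, rapidlyDecreasing_single 0 1⟩
  mul_comm a b := Subtype.ext (conv_comm _ _)
  mul_assoc a b c := Subtype.ext (conv_assoc a.2 b.2 c.2)
  one_mul a := Subtype.ext (wone_conv _)
  mul_one a := Subtype.ext ((conv_comm _ _).trans (wone_conv _))
  left_distrib a b c := Subtype.ext (conv_add a.2 b.2 c.2)
  right_distrib a b c := Subtype.ext <| by
    change conv (a.1 + b.1) c.1 = conv a.1 c.1 + conv b.1 c.1
    rw [conv_comm _ c.1, conv_comm _ c.1, conv_comm _ c.1]
    exact conv_add c.2 a.2 b.2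
  zero_mul a := Subtype.ext <| by
    funext n
    change ∑' m, (0 : ℂ) * _ = 0
    simp
  mul_zero a := Subtype.ext <| by
    funext n
    change ∑' m, _ * (0 : ℂ) = 0
    simp

lemma coe_mul (a b : W) : (a * b).1 = conv a.1 b.1 := rfl

lemma coe_one : (1 : W).1 = wone := rfl

/-- The derivation `z d/dz` of the Wiener algebra. -/
def euler (a : W) : W :=
  ⟨fun n => n * a.1 n, fun k => by
    obtain ⟨C, hC⟩ := a.2 (k + 1)
    refine ⟨C, fun n => le_trans ?_ (hC n)⟩
    rw [norm_mul, pow_succ, mul_assoc, Complex.norm_intCast]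
    gcongr
    linarith⟩

lemma euler_apply (a : W) (n : ℤ) : (euler a).1 n = n * a.1 n := rfl

lemma euler_mul (a b : W) : euler (a * b) = euler a * b + a * euler b := by
  refine Subtype.ext (funext fun n => ?_)
  change n * conv a.1 b.1 n = conv (euler a).1 b.1 n + conv a.1 (euler b).1 n
  unfold _root_.conv
  rw [← tsum_mul_left, ← (summable_conv (euler a).2 (RapidlyDecreasing.bounded b.2) n).tsum_add
    (summable_conv a.2 (RapidlyDecreasing.bounded (euler b).2) n)]
  refine tsum_congr fun m => ?_
  rw [euler_apply, euler_apply]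
  push_cast
  ring

lemma eq_one_of_euler_eq_zero {a : W} (h : euler a = 0) (h0 : a.1 0 = 1) : a = 1 := by
  refine Subtype.ext (funext fun n => ?_)
  rw [coe_one, wone]
  split_ifs with hn
  · rw [hn, h0]
  · have : (n : ℂ) * a.1 n = 0 := by rw [← euler_apply, h]; rfl
    exact (mul_eq_zero.1 this).resolve_left (by exact_mod_cast hn)

/-- The coefficients of the power series `E` with `E(0) = 1` and whose logarithmic Euler
derivative is `d`. -/
noncomputable def expCoeff (d : ℤ → ℂ) : ℕ → ℂ
  | 0 => 1
  | n + 1 => ((n : ℂ) + 1)⁻¹ * ∑ k : Fin (n + 1), expCoeff d k * d ((n : ℤ) + 1 - (k : ℕ))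

lemma mul_expCoeff (d : ℤ → ℂ) (n : ℕ) :
    n * expCoeff d n = ∑ k ∈ Finset.range n, expCoeff d k * d ((n : ℤ) - k) := by
  cases n with
  | zero => simp
  | succ n =>
    rw [expCoeff, Fin.sum_univ_eq_sum_range fun k => expCoeff d k * d ((n : ℤ) + 1 - (k : ℕ))]
    push_cast
    rw [mul_inv_cancel_left₀]
    exact_mod_cast n.succ_ne_zero

/-- The sequence `expCoeff` extended by zero to negative indices. -/
noncomputable def expSeq (d : ℤ → ℂ) (n : ℤ) : ℂ := if n < 0 then 0 else expCoeff d n.toNat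

lemma expSeq_natCast (d : ℤ → ℂ) (n : ℕ) : expSeq d n = expCoeff d n := by
  simp [expSeq]

lemma strictlyHolomorphic_expSeq (d : ℤ → ℂ) : StrictlyHolomorphic (expSeq d) :=
  ⟨by simp [expSeq, expCoeff], fun n hn => by simp [expSeq, hn]⟩

lemma mul_expSeq {d : ℤ → ℂ} (hd : ∀ n ≤ 0, d n = 0) (n : ℤ) :
    n * expSeq d n = conv d (expSeq d) n := by
  rw [conv_comm]
  unfold _root_.conv
  rcases lt_or_ge n 0 with hn | hn
  · rw [(strictlyHolomorphic_expSeq d).2 n hn, mul_zero, eq_comm]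
    refine (tsum_congr fun m => ?_).trans tsum_zero
    rcases lt_or_ge m 0 with hm | hm
    · rw [(strictlyHolomorphic_expSeq d).2 m hm, zero_mul]
    · rw [hd _ (by omega), mul_zero]
  · lift n to ℕ using hn
    rw [expSeq_natCast, Int.cast_natCast, mul_expCoeff,
      tsum_eq_sum (s := (Finset.range n).map Nat.castEmbedding) fun m hm => ?_, Finset.sum_map]
    · simp [expSeq_natCast]
    · rcases lt_or_ge m 0 with h0 | h0
      · rw [(strictlyHolomorphic_expSeq d).2 m h0, zero_mul]
      · lift m to ℕ using h0
        have : ¬ m < n := by simpa using hm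
        rw [hd _ (by omega), mul_zero]

lemma expCoeff_bounded {d : ℤ → ℂ} (hd : RapidlyDecreasing d) :
    ∃ C, ∀ n, ‖expCoeff d n‖ ≤ C := by
  have hs := RapidlyDecreasing.summable_norm hd
  obtain ⟨N, hN⟩ := exists_nat_ge (∑' n, ‖d n‖)
  refine ⟨∑ j ∈ Finset.range (N + 1), ‖expCoeff d j‖, fun n => ?_⟩
  set C := ∑ j ∈ Finset.range (N + 1), ‖expCoeff d j‖
  have hC : 0 ≤ C := Finset.sum_nonneg fun _ _ => norm_nonneg _
  induction n using Nat.strong_induction_on with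
  | _ n ih =>
    by_cases hn : n < N + 1
    · exact Finset.single_le_sum (f := fun j => ‖expCoeff d j‖) (fun _ _ => norm_nonneg _)
        (Finset.mem_range.2 hn)
    · have hpos : (0 : ℝ) < n := by exact_mod_cast (by omega : 0 < n)
      have hNn : (N : ℝ) ≤ n := by exact_mod_cast (by omega : N ≤ n)
      have hinj : Function.Injective fun k : ℕ => (n : ℤ) - k := fun x y h => by
        simpa using h
      refine le_of_mul_le_mul_left ?_ hpos
      calc (n : ℝ) * ‖expCoeff d n‖ = ‖(n : ℂ) * expCoeff d n‖ := by simp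
        _ = ‖∑ k ∈ Finset.range n, expCoeff d k * d ((n : ℤ) - k)‖ := by rw [mul_expCoeff]
        _ ≤ ∑ k ∈ Finset.range n, C * ‖d ((n : ℤ) - k)‖ := by
          refine norm_sum_le_of_le _ fun k hk => ?_
          rw [norm_mul]
          gcongr
          exact ih k (Finset.mem_range.1 hk)
        _ = C * ∑ k ∈ Finset.range n, ‖d ((n : ℤ) - k)‖ := by rw [Finset.mul_sum]
        _ ≤ C * ∑' k : ℕ, ‖d ((n : ℤ) - k)‖ := by
          gcongr
          exact (hs.comp_injective hinj).sum_le_tsum _ fun _ _ => norm_nonneg _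
        _ ≤ C * ∑' k, ‖d k‖ := by
          gcongr
          exact (hs.comp_injective hinj).tsum_le_tsum_of_inj _ hinj
            (fun _ _ => norm_nonneg _) (fun _ => le_rfl) hs
        _ ≤ n * C := by
          rw [mul_comm]
          gcongr
          exact hN.trans hNn

lemma rapidlyDecreasing_expSeq {d : ℤ → ℂ} (hd : RapidlyDecreasing d)
    (hd0 : ∀ n ≤ 0, d n = 0) : RapidlyDecreasing (expSeq d) := fun k => by
  induction k with
  | zero =>
    obtain ⟨C, hC⟩ := expCoeff_bounded hd
    refine ⟨C, fun n => ?_⟩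
    rw [pow_zero, one_mul, expSeq]
    split_ifs
    · simpa using (norm_nonneg _).trans (hC 0)
    · exact hC _
  | succ k ih =>
    obtain ⟨C, hC⟩ := ih
    obtain ⟨C', hC'⟩ := conv_weighted_bound hd k ⟨C, hC⟩
    refine ⟨C + C', fun n => ?_⟩
    refine le_trans (le_of_eq ?_) (add_le_add (hC n) (hC' n))
    rw [← mul_expSeq hd0, norm_mul, Complex.norm_intCast]
    ring

/-- Exponentials of sequences supported on positive indices, described by their
logarithmic derivatives. -/
lemma exists_holomorphic_exp (d : W) (hd : ∀ n ≤ 0, d.1 n = 0) :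
    ∃ E F : W, StrictlyHolomorphic E.1 ∧ StrictlyHolomorphic F.1 ∧
      euler E = d * E ∧ euler F = -d * F ∧ E * F = 1 := by
  have hd' : ∀ n ≤ 0, (-d).1 n = 0 := fun n hn => by
    change -d.1 n = 0
    rw [hd n hn, neg_zero]
  let E : W := ⟨expSeq d.1, rapidlyDecreasing_expSeq d.2 hd⟩
  let F : W := ⟨expSeq (-d).1, rapidlyDecreasing_expSeq (-d).2 hd'⟩
  have hE : StrictlyHolomorphic E.1 := strictlyHolomorphic_expSeq _
  have hF : StrictlyHolomorphic F.1 := strictlyHolomorphic_expSeq _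
  have hdE : euler E = d * E := Subtype.ext (funext (mul_expSeq hd))
  have hdF : euler F = -d * F := Subtype.ext (funext (mul_expSeq hd'))
  refine ⟨E, F, hE, hF, hdE, hdF, eq_one_of_euler_eq_zero ?_ ?_⟩
  · rw [euler_mul, hdE, hdF]
    ring
  · rw [coe_mul, _root_.conv, tsum_eq_single 0 fun m hm => ?_]
    · simp [hE.1, hF.1]
    · rcases lt_or_gt_of_ne hm with h | h
      · rw [hE.2 m h, zero_mul]
      · rw [hF.2 _ (by omega), mul_zero]

/-- The reflection `n ↦ -n` of the Wiener algebra. -/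
def reflect (a : W) : W :=
  ⟨fun n => a.1 (-n), fun k => by
    obtain ⟨C, hC⟩ := a.2 k
    exact ⟨C, fun n => by simpa using hC (-n)⟩⟩

lemma reflect_mul (a b : W) : reflect (a * b) = reflect a * reflect b := by
  refine Subtype.ext (funext fun n => ?_)
  change conv a.1 b.1 (-n) = ∑' m, a.1 (-m) * b.1 (-(n - m))
  rw [_root_.conv, ← (Equiv.neg ℤ).tsum_eq]
  exact tsum_congr fun m => by
    rw [Equiv.neg_apply, show -n - -m = -(n - m) by ring]

lemma reflect_one : reflect 1 = 1 :=
  Subtype.ext (funext fun n => by simp [reflect, coe_one, wone])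

lemma reflect_reflect (a : W) : reflect (reflect a) = a :=
  Subtype.ext (funext fun n => by simp [reflect])

lemma reflect_neg (a : W) : reflect (-a) = -reflect a := rfl

lemma euler_reflect (a : W) : euler (reflect a) = -reflect (euler a) := by
  refine Subtype.ext (funext fun n => ?_)
  change n * a.1 (-n) = -((-n : ℤ) * a.1 (-n))
  push_cast
  ring

lemma strictlyAntiholomorphic_reflect {a : W} (ha : StrictlyHolomorphic a.1) :
    StrictlyAntiholomorphic (reflect a).1 :=
  ⟨by simpa [reflect] using ha.1, fun n hn => ha.2 (-n) (by omega)⟩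

lemma exists_antiholomorphic_exp (d : W) (hd : ∀ n, 0 ≤ n → d.1 n = 0) :
    ∃ E F : W, StrictlyAntiholomorphic E.1 ∧ StrictlyAntiholomorphic F.1 ∧
      euler E = d * E ∧ euler F = -d * F ∧ E * F = 1 := by
  obtain ⟨E, F, hE, hF, hdE, hdF, hEF⟩ := exists_holomorphic_exp (-reflect d) fun n hn => by
    change -d.1 (-n) = 0
    rw [hd _ (by omega), neg_zero]
  refine ⟨reflect E, reflect F, strictlyAntiholomorphic_reflect hE,
    strictlyAntiholomorphic_reflect hF, ?_, ?_, ?_⟩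
  · rw [euler_reflect, hdE, reflect_mul, reflect_neg, reflect_reflect]
    ring
  · rw [euler_reflect, hdF, reflect_mul, neg_neg, reflect_reflect]
    ring
  · rw [← reflect_mul, hEF, reflect_one]

/-- The part of a sequence supported on a set of indices. -/
noncomputable def restrict (s : Set ℤ) (a : W) : W :=
  ⟨s.indicator a.1, rapidlyDecreasing_of_norm_le a.2 fun _ => norm_indicator_le_norm_self _ _⟩

/-- The monomial `c z ^ p`. -/
def monomial (p : ℤ) (c : ℂ) : W := ⟨fun n => if n = p then c else 0, rapidlyDecreasing_single p c⟩

lemma monomial_zero_mul_apply (c : ℂ) (a : W) (n : ℤ) : (monomial 0 c * a).1 n = c * a.1 n := by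
  change ∑' m, (if m = 0 then c else 0) * a.1 (n - m) = _
  rw [tsum_eq_single 0 fun m hm => by simp [hm]]
  simp

lemma eq_restrict_add_monomial (d : W) :
    d = restrict (Set.Ioi 0) d + restrict (Set.Iio 0) d + monomial 0 (d.1 0) := by
  refine Subtype.ext (funext fun n => ?_)
  change d.1 n = (Set.Ioi 0).indicator d.1 n + (Set.Iio 0).indicator d.1 n +
    if n = 0 then d.1 0 else 0
  rcases lt_trichotomy n 0 with h | h | h
  · simp [h, h.ne, h.le]
  · simp [h]
  · simp [h, h.ne', h.le]

/-- An element whose logarithmic derivative is constant is a monomial. -/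
lemma exists_eq_monomial {q : W} {c : ℂ} (hq : q ≠ 0) (h : euler q = monomial 0 c * q) :
    ∃ (p : ℤ) (c' : ℂ), c' ≠ 0 ∧ q = monomial p c' := by
  have hn : ∀ n : ℤ, (n : ℂ) * q.1 n = c * q.1 n := fun n => by
    rw [← euler_apply, h, monomial_zero_mul_apply]
  obtain ⟨p, hp⟩ : ∃ p, q.1 p ≠ 0 := by
    by_contra! h0
    exact hq (Subtype.ext (funext h0))
  have hc : (p : ℂ) = c := mul_right_cancel₀ hp (hn p)
  refine ⟨p, q.1 p, hp, Subtype.ext (funext fun n => ?_)⟩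
  change q.1 n = if n = p then q.1 p else 0
  split_ifs with hnp
  · rw [hnp]
  · by_contra h0
    have : (n : ℂ) = p := (mul_right_cancel₀ h0 (hn n)).trans hc.symm
    exact hnp (by exact_mod_cast this)

end WienerAlgebra

open WienerAlgebra in
/-- Wiener–Hopf factorization over `ℂ`: an invertible element of the
Wiener algebra `W(ℂ)` factors as `a = a⁻ * m * a⁺` with `a⁻` a strictly antiholomorphic
unit with strictly antiholomorphic inverse, `m` an invertible monomial, and `a⁺` a
strictly holomorphic unit with strictly holomorphic inverse. -/
theorem wiener_hopf_complex (a b : ℤ → ℂ)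
    (ha : RapidlyDecreasing a) (hb : RapidlyDecreasing b)
    (hab : conv a b = wone) :
    ∃ (p : ℤ) (c : ℂ) (aminus aplus : ℤ → ℂ), c ≠ 0 ∧
      RapidlyDecreasing aminus ∧ StrictlyAntiholomorphic aminus ∧
      (∃ bminus : ℤ → ℂ, RapidlyDecreasing bminus ∧ conv aminus bminus = wone ∧
        StrictlyAntiholomorphic bminus) ∧
      RapidlyDecreasing aplus ∧ StrictlyHolomorphic aplus ∧
      (∃ bplus : ℤ → ℂ, RapidlyDecreasing bplus ∧ conv aplus bplus = wone ∧
        StrictlyHolomorphic bplus) ∧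
      a = conv aminus (conv (fun n => if n = p then c else 0) aplus) := by
  let x : W := ⟨a, ha⟩
  let y : W := ⟨b, hb⟩
  have hxy : x * y = 1 := Subtype.ext hab
  let d : W := euler x * y
  have hd : euler x = d * x := by
    linear_combination -euler x * hxy
  obtain ⟨E, F, hE, hF, -, hdF, hEF⟩ := exists_holomorphic_exp (restrict (Set.Ioi 0) d)
    fun n hn => Set.indicator_of_notMem (by simpa using hn) _
  obtain ⟨G, H, hG, hH, -, hdH, hGH⟩ := exists_antiholomorphic_exp (restrict (Set.Iio 0) d)
    fun n hn => Set.indicator_of_notMem (by simpa using hn) _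
  have hq : euler (x * (F * H)) = monomial 0 (d.1 0) * (x * (F * H)) := by
    rw [euler_mul, euler_mul, hd, hdF, hdH]
    linear_combination (x * (F * H)) * eq_restrict_add_monomial d
  have hq0 : x * (F * H) ≠ 0 := fun h => by
    have h1 : (1 : W) = 0 := by
      linear_combination y * E * G * h - hxy - x * y * hEF - x * y * E * F * hGH
    have h2 : (1 : ℂ) = 0 := congrFun (congrArg Subtype.val h1) 0
    exact one_ne_zero h2
  obtain ⟨p, c, hc, hm⟩ := exists_eq_monomial hq0 hq
  refine ⟨p, c, G.1, E.1, hc, G.2, hG, ⟨H.1, H.2, congrArg Subtype.val hGH, hH⟩,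
    E.2, hE, ⟨F.1, F.2, congrArg Subtype.val hEF, hF⟩, ?_⟩
  have hx : x = G * (monomial p c * E) := by
    rw [← hm]
    linear_combination -x * hEF - x * E * F * hGH
  exact congrArg Subtype.val hx
end

section
/- Let A be a commutative complex Banach algebra with unit, and let a be an orthogonal unit of the Wiener algebra W(A) with inverse b. Set Π_n = a(n)·b(−n) for n ∈ ℤ. Then each Π_n is an idempotent of A, the family {Π_n}_{n∈ℤ} is pairwise orthogonal (Π_n·Π_m = 0 for n ≠ m), the series Σ_{n∈ℤ} Π_n converges absolutely to 1 in A, and a(n)·Π_m = a(n) if n = m while a(n)·Π_m = 0 if n ≠ m. -/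
open scoped BigOperators

theorem RapidlyDecreasing.summable_norm {A : Type*} [NormedRing A] {a : ℤ → A}
    (ha : RapidlyDecreasing a) : Summable fun n : ℤ => ‖a n‖ := by
  obtain ⟨C, hC⟩ := ha 2
  have hs : Summable fun n : ℤ => C * (1 / |(n : ℝ)| ^ 2) := by
    simpa using (Real.summable_one_div_int_pow.mpr one_lt_two).mul_left C
  refine hs.of_norm_bounded_eventually ?_
  filter_upwards [(Set.finite_singleton (0 : ℤ)).compl_mem_cofinite] with n hn
  have hn0 : (n : ℝ) ≠ 0 := by exact_mod_cast hn
  have hpos : 0 < |(n : ℝ)| := abs_pos.mpr hn0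
  rw [norm_norm, mul_one_div, le_div_iff₀ (by positivity)]
  calc ‖a n‖ * |(n : ℝ)| ^ 2 ≤ ‖a n‖ * (1 + |(n : ℝ)|) ^ 2 := by gcongr; linarith
    _ = (1 + |(n : ℝ)|) ^ 2 * ‖a n‖ := mul_comm _ _
    _ ≤ C := hC n

theorem RapidlyDecreasing.summable_norm_mul {A : Type*} [NormedRing A] {a b : ℤ → A}
    (ha : RapidlyDecreasing a) (hb : RapidlyDecreasing b) (k : ℤ) :
    Summable fun n : ℤ => ‖a n * b (k - n)‖ := by
  obtain ⟨C, hC⟩ := hb 0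
  refine Summable.of_nonneg_of_le (fun _ => norm_nonneg _) (fun n => ?_)
    (ha.summable_norm.mul_right C)
  have hbn : ‖b (k - n)‖ ≤ C := by simpa using hC (k - n)
  exact (norm_mul_le _ _).trans (by gcongr)

/-- For an orthogonal unit `a` of `W(A)` with inverse `b`, the elements
`Π_n = a(n)·b(−n)` are pairwise orthogonal idempotents, `∑ Π_n` converges absolutely
to `1`, and `a(n)·Π_m = δ_{n,m}·a(n)`. -/
theorem orthogonal_idempotent_family {A : Type*} [NormedCommRing A] [NormedAlgebra ℂ A]
    [CompleteSpace A] (a b : ℤ → A)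
    (ha : RapidlyDecreasing a) (horth : OrthogonalSeq a)
    (hb : RapidlyDecreasing b) (hab : conv a b = wone) :
    (∀ n : ℤ, (a n * b (-n)) * (a n * b (-n)) = a n * b (-n)) ∧
    (∀ n m : ℤ, n ≠ m → (a n * b (-n)) * (a m * b (-m)) = 0) ∧
    (Summable fun n : ℤ => ‖a n * b (-n)‖) ∧
    HasSum (fun n : ℤ => a n * b (-n)) 1 ∧
    (∀ n m : ℤ, a n * (a m * b (-m)) = if n = m then a n else 0) := by
  have hsum : Summable fun n : ℤ => ‖a n * b (-n)‖ := by
    simpa using ha.summable_norm_mul hb 0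
  have hone : HasSum (fun n : ℤ => a n * b (-n)) 1 := by
    have h0 : ∑' n : ℤ, a n * b (-n) = 1 := by simpa [conv, wone] using congrFun hab 0
    exact h0 ▸ hsum.of_norm.hasSum
  have hne : ∀ n m : ℤ, n ≠ m → a n * (a m * b (-m)) = 0 := fun n m h => by
    rw [← mul_assoc, horth n m h, zero_mul]
  have hself : ∀ n : ℤ, a n * (a n * b (-n)) = a n := fun n =>
    (hasSum_single n fun m hm => hne n m hm.symm).unique (by simpa using hone.mul_left (a n))
  refine ⟨fun n => ?_, fun n m h => ?_, hsum, hone, fun n m => ?_⟩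
  · rw [mul_right_comm, hself]
  · rw [mul_right_comm, hne n m h, zero_mul]
  · split_ifs with h
    · rw [← h, hself]
    · exact hne n m h
end

section
/- Let A be a commutative complex Banach algebra with unit, and let a be a unit of the Wiener algebra W(A). Suppose {Π_n}_{n∈ℤ} is a family of pairwise orthogonal idempotents of A with Σ_{n∈ℤ} Π_n converging to 1, and suppose a is subordinated to it, i.e. a(n)·Π_m = a(n) if n = m and a(n)·Π_m = 0 if n ≠ m. Then a is orthogonal (a(n)·a(m)=0 for n≠m), and the subordinating family is unique: necessarily Π_n = a(n)·b(−n) for all n, where b is the inverse of a in W(A). -/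
open scoped BigOperators

/-- If a unit `a` of `W(A)` is subordinated to a family of pairwise
orthogonal idempotents `{Π_n}` summing to `1`, then `a` is orthogonal and the family
is unique: `Π_n = a(n)·b(−n)` where `b` is the inverse of `a`. -/
theorem subordinated_orthogonal_unique {A : Type*} [NormedCommRing A] [NormedAlgebra ℂ A]
    [CompleteSpace A] (a b : ℤ → A) (P : ℤ → A)
    (ha : RapidlyDecreasing a) (hb : RapidlyDecreasing b) (hab : conv a b = wone)
    (hidem : ∀ n : ℤ, P n * P n = P n)
    (horth : ∀ n m : ℤ, n ≠ m → P n * P m = 0)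
    (hsum : HasSum P (1 : A))
    (hsub : ∀ n m : ℤ, a n * P m = if n = m then a n else 0) :
    OrthogonalSeq a ∧ ∀ n : ℤ, P n = a n * b (-n) := by
  refine ⟨fun n m hnm => ?_, fun n => ?_⟩
  · have hm : a m * P m = a m := by simp [hsub]
    have hn : a n * P m = 0 := by simp [hsub, hnm]
    rw [← hm, mul_left_comm, hn, mul_zero]
  · have hone : ∑' m : ℤ, a m * b (-m) = 1 := by
      simpa [conv, wone] using congrFun hab 0
    by_cases hs : Summable fun m : ℤ => a m * b (-m)
    · have hterm (m : ℤ) : a m * b (-m) * P n = if m = n then a n * b (-n) else 0 := by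
        rw [mul_right_comm, hsub]
        split_ifs with h
        · rw [h]
        · exact zero_mul _
      calc P n = (∑' m : ℤ, a m * b (-m)) * P n := by rw [hone, one_mul]
        _ = ∑' m : ℤ, a m * b (-m) * P n := (hs.tsum_mul_right _).symm
        _ = a n * b (-n) := by simp_rw [hterm, tsum_ite_eq]
    · -- A divergent sum has the value `0`, so `A` is trivial.
      rw [tsum_eq_zero_of_not_summable hs] at hone
      exact eq_of_zero_eq_one hone _ _
end

section
/- Let A be a commutative complex Banach algebra with unit. If a₁ and a₂ are orthogonal units of the Wiener algebra W(A), with associated idempotent families {Π¹_n}_{n∈ℤ} and {Π²_n}_{n∈ℤ} respectively, then a = a₁*a₂ is an orthogonal unit of W(A), and its associated idempotent family is Π_n = Σ_{m∈ℤ} Π¹_m·Π²_{n−m} (the sum converging absolutely in A). In particular, the orthogonal units of W(A) form a subgroup of the unit group of W(A). -/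
open scoped BigOperators

namespace RapidlyDecreasing

variable {A : Type*} [NormedRing A] {a b : ℤ → A}

theorem summable_pow_mul_norm (ha : RapidlyDecreasing a) (k : ℕ) :
    Summable fun n : ℤ => (1 + |(n : ℝ)|) ^ k * ‖a n‖ := by
  obtain ⟨C, hC⟩ := ha (k + 2)
  have hs : Summable fun n : ℤ => C * (1 / (n : ℝ) ^ 2) :=
    (Real.summable_one_div_int_pow.mpr one_lt_two).mul_left C
  refine hs.of_norm_bounded_eventually ?_
  filter_upwards [(Set.finite_singleton (0 : ℤ)).compl_mem_cofinite] with n hn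
  have hn' : (n : ℝ) ≠ 0 := Int.cast_ne_zero.mpr (by simpa using hn)
  rw [Real.norm_of_nonneg (by positivity), mul_one_div, le_div_iff₀ (by positivity)]
  refine le_trans ?_ (hC n)
  have h : (n : ℝ) ^ 2 ≤ (1 + |(n : ℝ)|) ^ 2 := by
    nlinarith [sq_abs (n : ℝ), abs_nonneg (n : ℝ)]
  calc (1 + |(n : ℝ)|) ^ k * ‖a n‖ * (n : ℝ) ^ 2
      ≤ (1 + |(n : ℝ)|) ^ k * ‖a n‖ * (1 + |(n : ℝ)|) ^ 2 := by gcongr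
    _ = (1 + |(n : ℝ)|) ^ (k + 2) * ‖a n‖ := by ring

theorem summable_norm_s8 (ha : RapidlyDecreasing a) : Summable fun n => ‖a n‖ := by
  simpa using ha.summable_pow_mul_norm 0

theorem exists_norm_le (ha : RapidlyDecreasing a) : ∃ C, ∀ n, ‖a n‖ ≤ C := by
  simpa using ha 0

/-- The terms of the convolution product are absolutely summable. -/
theorem summable_norm_mul_s8 (ha : RapidlyDecreasing a) (hb : RapidlyDecreasing b) (n : ℤ) :
    Summable fun m : ℤ => ‖a m * b (n - m)‖ := by
  obtain ⟨C, hC⟩ := hb.exists_norm_le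
  refine (ha.summable_norm_s8.mul_right C).of_nonneg_of_le (fun _ => norm_nonneg _) fun m => ?_
  exact (norm_mul_le _ _).trans (mul_le_mul_of_nonneg_left (hC _) (norm_nonneg _))

theorem mul_neg (ha : RapidlyDecreasing a) (hb : RapidlyDecreasing b) :
    RapidlyDecreasing fun n => a n * b (-n) := by
  obtain ⟨C, hC⟩ := hb.exists_norm_le
  intro k
  obtain ⟨D, hD⟩ := ha k
  refine ⟨D * C, fun n => ?_⟩
  calc (1 + |(n : ℝ)|) ^ k * ‖a n * b (-n)‖
      ≤ (1 + |(n : ℝ)|) ^ k * (‖a n‖ * ‖b (-n)‖) := by gcongr; exact norm_mul_le _ _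
    _ = (1 + |(n : ℝ)|) ^ k * ‖a n‖ * ‖b (-n)‖ := by ring
    _ ≤ D * C := mul_le_mul (hD n) (hC _) (norm_nonneg _) (le_trans (by positivity) (hD n))

theorem conv (ha : RapidlyDecreasing a) (hb : RapidlyDecreasing b) :
    RapidlyDecreasing (conv a b) := by
  intro k
  obtain ⟨C, hC⟩ := hb k
  have hs := (ha.summable_pow_mul_norm k).mul_right C
  refine ⟨∑' m : ℤ, (1 + |(m : ℝ)|) ^ k * ‖a m‖ * C, fun n => ?_⟩
  have hn := ha.summable_norm_mul_s8 hb n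
  calc (1 + |(n : ℝ)|) ^ k * ‖∑' m : ℤ, a m * b (n - m)‖
      ≤ (1 + |(n : ℝ)|) ^ k * ∑' m : ℤ, ‖a m * b (n - m)‖ := by
        gcongr; exact norm_tsum_le_tsum_norm hn
    _ = ∑' m : ℤ, (1 + |(n : ℝ)|) ^ k * ‖a m * b (n - m)‖ := tsum_mul_left.symm
    _ ≤ ∑' m : ℤ, (1 + |(m : ℝ)|) ^ k * ‖a m‖ * C := by
        refine (hn.mul_left _).tsum_le_tsum (fun m => ?_) hs
        have hw : 1 + |(n : ℝ)| ≤ (1 + |(m : ℝ)|) * (1 + |((n - m : ℤ) : ℝ)|) := by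
          have h : |(n : ℝ)| ≤ |(m : ℝ)| + |((n - m : ℤ) : ℝ)| := by
            simpa using abs_add_le (m : ℝ) ((n - m : ℤ) : ℝ)
          nlinarith [mul_nonneg (abs_nonneg (m : ℝ)) (abs_nonneg ((n - m : ℤ) : ℝ))]
        calc (1 + |(n : ℝ)|) ^ k * ‖a m * b (n - m)‖
            ≤ ((1 + |(m : ℝ)|) * (1 + |((n - m : ℤ) : ℝ)|)) ^ k * (‖a m‖ * ‖b (n - m)‖) := by
              gcongr; exact norm_mul_le _ _
          _ = (1 + |(m : ℝ)|) ^ k * ‖a m‖ *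
              ((1 + |((n - m : ℤ) : ℝ)|) ^ k * ‖b (n - m)‖) := by rw [mul_pow]; ring
          _ ≤ _ := mul_le_mul_of_nonneg_left (hC _) (by positivity)

theorem tsum_conv [CompleteSpace A] (ha : RapidlyDecreasing a) (hb : RapidlyDecreasing b) :
    ∑' n, _root_.conv a b n = (∑' n, a n) * ∑' n, b n := by
  have hs := summable_mul_of_summable_norm ha.summable_norm_s8 hb.summable_norm_s8
  let e : ℤ × ℤ ≃ ℤ × ℤ :=
    { toFun := fun p => (p.2, p.1 - p.2)
      invFun := fun p => (p.1 + p.2, p.1)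
      left_inv := fun p => by simp
      right_inv := fun p => by simp }
  rw [tsum_mul_tsum_of_summable_norm ha.summable_norm_s8 hb.summable_norm_s8, ← e.tsum_eq]
  exact ((e.summable_iff.mpr hs).tsum_prod).symm

end RapidlyDecreasing

section

variable {A : Type*} [NormedCommRing A] [CompleteSpace A]

/-- If `b` is the inverse of the orthogonal series `a`, then `a n * b m = 0` unless `m = -n`. -/
theorem OrthogonalSeq.mul_inverse_eq_zero {a b : ℤ → A} (horth : OrthogonalSeq a)
    (ha : RapidlyDecreasing a) (hb : RapidlyDecreasing b) (hab : conv a b = wone)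
    {n m : ℤ} (hnm : n + m ≠ 0) : a n * b m = 0 := by
  have key (k : ℤ) : a n * (a n * b (k - n)) = a n * wone k := by
    rw [← hab, conv, ← (ha.summable_norm_mul_s8 hb k).of_norm.tsum_mul_left, tsum_eq_single n]
    intro j hj
    rw [← mul_assoc, horth n j hj.symm, zero_mul]
  have h₀ : a n = a n * (a n * b (-n)) := by simpa [wone] using (key 0).symm
  have h₁ : a n * (a n * b m) = 0 := by simpa [wone, hnm] using key (n + m)
  calc a n * b m = a n * (a n * b (-n)) * b m := by rw [← h₀]
    _ = a n * (a n * b m) * b (-n) := by ring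
    _ = 0 := by rw [h₁, zero_mul]

theorem conv_mul_conv {a b c d : ℤ → A} (ha : RapidlyDecreasing a) (hb : RapidlyDecreasing b)
    (hc : RapidlyDecreasing c) (hd : RapidlyDecreasing d) (n m : ℤ) :
    conv a b n * conv c d m =
      ∑' i : ℤ, ∑' j : ℤ, (a i * c j) * (b (n - i) * d (m - j)) := by
  rw [conv, conv, ← (ha.summable_norm_mul_s8 hb n).of_norm.tsum_mul_right]
  refine tsum_congr fun i => ?_
  rw [← (hc.summable_norm_mul_s8 hd m).of_norm.tsum_mul_left]
  exact tsum_congr fun j => by ring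

end

/-- The product of two orthogonal units of `W(A)` is an orthogonal unit,
its inverse being the product of the inverses, and its associated idempotent family is
the (absolutely convergent) convolution of the two idempotent families.  In particular
the orthogonal units form a subgroup of the unit group of `W(A)`. -/
theorem orthogonal_units_closed_under_mul {A : Type*} [NormedCommRing A]
    [NormedAlgebra ℂ A] [CompleteSpace A] (a₁ b₁ a₂ b₂ : ℤ → A)
    (ha₁ : RapidlyDecreasing a₁) (horth₁ : OrthogonalSeq a₁)
    (hb₁ : RapidlyDecreasing b₁) (hab₁ : conv a₁ b₁ = wone)
    (ha₂ : RapidlyDecreasing a₂) (horth₂ : OrthogonalSeq a₂)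
    (hb₂ : RapidlyDecreasing b₂) (hab₂ : conv a₂ b₂ = wone) :
    RapidlyDecreasing (conv a₁ a₂) ∧
    RapidlyDecreasing (conv b₁ b₂) ∧
    conv (conv a₁ a₂) (conv b₁ b₂) = wone ∧
    OrthogonalSeq (conv a₁ a₂) ∧
    (∀ n : ℤ, Summable fun m : ℤ => ‖(a₁ m * b₁ (-m)) * (a₂ (n - m) * b₂ (-(n - m)))‖) ∧
    (∀ n : ℤ, conv a₁ a₂ n * conv b₁ b₂ (-n) =
      ∑' m : ℤ, (a₁ m * b₁ (-m)) * (a₂ (n - m) * b₂ (-(n - m)))) := by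
  have hz₁ {n m : ℤ} : n + m ≠ 0 → a₁ n * b₁ m = 0 := horth₁.mul_inverse_eq_zero ha₁ hb₁ hab₁
  have hz₂ {n m : ℤ} : n + m ≠ 0 → a₂ n * b₂ m = 0 := horth₂.mul_inverse_eq_zero ha₂ hb₂ hab₂
  have hp₁ := ha₁.mul_neg hb₁
  have hp₂ := ha₂.mul_neg hb₂
  have hdiag (n : ℤ) : conv a₁ a₂ n * conv b₁ b₂ (-n) =
      ∑' m : ℤ, (a₁ m * b₁ (-m)) * (a₂ (n - m) * b₂ (-(n - m))) := by
    rw [conv_mul_conv ha₁ ha₂ hb₁ hb₂]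
    refine tsum_congr fun i => ?_
    rw [tsum_eq_single (-i) fun j hj => by rw [hz₁ (by lia), zero_mul]]
    congr 3
    ring
  have hoff (n m : ℤ) (hnm : n + m ≠ 0) : conv a₁ a₂ n * conv b₁ b₂ m = 0 := by
    rw [conv_mul_conv ha₁ ha₂ hb₁ hb₂]
    refine (tsum_congr fun i => (tsum_congr fun j => ?_).trans tsum_zero).trans tsum_zero
    by_cases hij : i + j = 0
    · rw [hz₂ (by lia), mul_zero]
    · rw [hz₁ hij, zero_mul]
  refine ⟨ha₁.conv ha₂, hb₁.conv hb₂, ?_, ?_, fun n => hp₁.summable_norm_mul_s8 hp₂ n, hdiag⟩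
  · funext n
    rcases eq_or_ne n 0 with rfl | hn
    · have h₁ : ∑' m, a₁ m * b₁ (-m) = 1 := by simpa [conv, wone] using congrFun hab₁ 0
      have h₂ : ∑' m, a₂ m * b₂ (-m) = 1 := by simpa [conv, wone] using congrFun hab₂ 0
      calc conv (conv a₁ a₂) (conv b₁ b₂) 0
          = ∑' m, conv (fun i => a₁ i * b₁ (-i)) (fun i => a₂ i * b₂ (-i)) m :=
            tsum_congr fun m => by rw [zero_sub]; exact hdiag m
        _ = wone 0 := by rw [hp₁.tsum_conv hp₂, h₁, h₂]; simp [wone]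
    · refine ((tsum_congr fun m => hoff m (n - m) (by lia)).trans tsum_zero).trans ?_
      simp [wone, hn]
  · intro n m hnm
    rw [conv_mul_conv ha₁ ha₂ ha₁ ha₂]
    refine (tsum_congr fun i => (tsum_congr fun j => ?_).trans tsum_zero).trans tsum_zero
    by_cases hij : i = j
    · rw [horth₂ (n - i) (m - j) (by lia), mul_zero]
    · rw [horth₁ i j hij, zero_mul]
end

section
/- Let A be a commutative complex Banach algebra with unit whose only idempotents are 0 and 1. Then an element a of the Wiener algebra W(A) is an orthogonal unit if and only if it is an invertible monomial, i.e. there exist p ∈ ℤ and a unit c of A such that a(p) = c and a(n) = 0 for all n ≠ p. In particular, for A = ℂ the orthogonal units of W(ℂ) are exactly the monomials c·δ_p with c ≠ 0. -/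
open scoped BigOperators

theorem RapidlyDecreasing.single {A : Type*} [NormedRing A] (p : ℤ) (c : A) :
    RapidlyDecreasing (fun n : ℤ => if n = p then c else 0) := by
  intro k
  refine ⟨(1 + |(p : ℝ)|) ^ k * ‖c‖, fun n => ?_⟩
  dsimp only
  split_ifs with hn
  · rw [hn]
  · rw [norm_zero, mul_zero]
    positivity

/-- If pairwise orthogonal elements sum to a nonzero `1`, each of them is idempotent. -/
theorem mul_self_eq_self_of_tsum_eq_one {ι A : Type*} [NormedRing A] [Nontrivial A]
    {f : ι → A} (hf : ∀ i j, i ≠ j → f i * f j = 0) (h1 : ∑' i, f i = 1) (i : ι) :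
    f i * f i = f i := by
  have hs : Summable f := by
    by_contra h
    exact zero_ne_one ((tsum_eq_zero_of_not_summable h).symm.trans h1)
  calc f i * f i = ∑' j, f i * f j := (tsum_eq_single i fun j hj => hf i j hj.symm).symm
    _ = f i * ∑' j, f j := hs.tsum_mul_left _
    _ = f i := by rw [h1, mul_one]

theorem exists_monomial_of_conv_eq_wone {A : Type*} [NormedCommRing A]
    (hind : ∀ x : A, x * x = x → x = 0 ∨ x = 1) {a b : ℤ → A}
    (ha : OrthogonalSeq a) (hab : conv a b = wone) :
    ∃ (p : ℤ) (c : A), IsUnit c ∧ a p = c ∧ ∀ n : ℤ, n ≠ p → a n = 0 := by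
  rcases subsingleton_or_nontrivial A with _ | _
  · exact ⟨0, a 0, isUnit_of_subsingleton _, rfl, fun n _ => Subsingleton.elim _ _⟩
  have h1 : ∑' m : ℤ, a m * b (0 - m) = 1 := by
    simpa [conv, wone] using congrFun hab 0
  have horth : ∀ m n : ℤ, m ≠ n → a m * b (0 - m) * (a n * b (0 - n)) = 0 := by
    intro m n hmn
    rw [mul_mul_mul_comm, ha m n hmn, zero_mul]
  obtain ⟨p, hp⟩ : ∃ p : ℤ, a p * b (0 - p) ≠ 0 := by
    by_contra! h
    simp only [h, tsum_zero] at h1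
    exact zero_ne_one h1
  have hp1 : a p * b (0 - p) = 1 :=
    (hind _ (mul_self_eq_self_of_tsum_eq_one horth h1 p)).resolve_left hp
  refine ⟨p, a p, IsUnit.of_mul_eq_one _ hp1, rfl, fun n hn => ?_⟩
  rw [← mul_one (a n), ← hp1, ← mul_assoc, ha n p hn, zero_mul]

theorem conv_eq_wone_of_monomial {A : Type*} [NormedRing A] {a : ℤ → A} {p : ℤ} {d : A}
    (hd : a p * d = 1) (h0 : ∀ n : ℤ, n ≠ p → a n = 0) :
    conv a (fun n => if n = -p then d else 0) = wone := by
  funext n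
  have hn : n - p = -p ↔ n = 0 := by lia
  simp only [conv, wone]
  rw [tsum_eq_single p fun m hm => by rw [h0 m hm, zero_mul]]
  simp only [hn, mul_ite, hd, mul_zero]

theorem orthogonalSeq_and_conv_eq_wone_iff {A : Type*} [NormedCommRing A]
    (hind : ∀ x : A, x * x = x → x = 0 ∨ x = 1) (a : ℤ → A) :
    (OrthogonalSeq a ∧ ∃ b : ℤ → A, RapidlyDecreasing b ∧ conv a b = wone) ↔
      ∃ (p : ℤ) (c : A), IsUnit c ∧ a p = c ∧ ∀ n : ℤ, n ≠ p → a n = 0 := by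
  constructor
  · rintro ⟨ha, b, -, hab⟩
    exact exists_monomial_of_conv_eq_wone hind ha hab
  · rintro ⟨p, c, hc, rfl, h0⟩
    obtain ⟨d, hd⟩ := hc.exists_right_inv
    refine ⟨fun n m hnm => ?_, _, .single (-p) d, conv_eq_wone_of_monomial hd h0⟩
    by_cases hn : n = p
    · rw [h0 m fun hm => hnm (hn.trans hm.symm), mul_zero]
    · rw [h0 n hn, zero_mul]

/-- Over a commutative complex Banach algebra whose only idempotents are
`0` and `1`, an element of `W(A)` is an orthogonal unit iff it is an invertible
monomial; in particular over `ℂ` the orthogonal units are exactly the monomials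
`c·δ_p` with `c ≠ 0`. -/
theorem orthogonal_unit_iff_monomial {A : Type*} [NormedCommRing A] [NormedAlgebra ℂ A]
    [CompleteSpace A]
    (hind : ∀ x : A, x * x = x → x = 0 ∨ x = 1) :
    (∀ a : ℤ → A, RapidlyDecreasing a →
      ((OrthogonalSeq a ∧ ∃ b : ℤ → A, RapidlyDecreasing b ∧ conv a b = wone) ↔
        ∃ (p : ℤ) (c : A), IsUnit c ∧ a p = c ∧ ∀ n : ℤ, n ≠ p → a n = 0)) ∧
    (∀ a : ℤ → ℂ, RapidlyDecreasing a →
      ((OrthogonalSeq a ∧ ∃ b : ℤ → ℂ, RapidlyDecreasing b ∧ conv a b = wone) ↔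
        ∃ (p : ℤ) (c : ℂ), c ≠ 0 ∧ a = fun n => if n = p then c else 0)) := by
  refine ⟨fun a _ => orthogonalSeq_and_conv_eq_wone_iff hind a, fun a _ => ?_⟩
  have hC : ∀ x : ℂ, x * x = x → x = 0 ∨ x = 1 := fun x hx =>
    IsIdempotentElem.iff_eq_zero_or_one.mp hx
  rw [orthogonalSeq_and_conv_eq_wone_iff hC a]
  constructor
  · rintro ⟨p, c, hc, hp, h0⟩
    refine ⟨p, c, hc.ne_zero, funext fun n => ?_⟩
    split_ifs with hn
    · rw [hn, hp]
    · exact h0 n hn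
  · rintro ⟨p, c, hc, rfl⟩
    exact ⟨p, c, hc.isUnit, if_pos rfl, fun n hn => if_neg hn⟩
end
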